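/- Let (Ω,𝓕,P) be a probability space and Z : Ω → ℝ^T a random vector, and let Y(ω) be given by the model with fixed X, β^{(0)},…,β^{(N)} and change-points η_1 < ⋯ < η_N. Let [s,e] ⊆ [1,T] be an interval such that for every j = 1,…,N, [η_j, η_j+1] ⊄ [s,e]. Then for every t ≥ 0, P( D_{[s,e]} > t ) ≤ P( ‖Z‖_{𝓘^a} > t ). -/

import Mathlib

open Finset MeasureTheory

/-- Scaled partial sum `U_{s,e}(y) = (e-s+1)^{-1/2} ∑_{t=s}^e y_t`. -/
noncomputable def scaledPartialSum (y : ℕ → ℝ) (s e : ℕ) : ℝ :=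
  (∑ t ∈ Finset.Icc s e, y t) / Real.sqrt ((e : ℝ) - (s : ℝ) + 1)

/-- Multiresolution sup-norm of `y` over the collection `I` of intervals (given
as pairs of endpoints). -/
noncomputable def mrNorm (y : ℕ → ℝ) (I : Set (ℕ × ℕ)) : ℝ :=
  sSup ((fun q : ℕ × ℕ => |scaledPartialSum y q.1 q.2|) '' I)

/-- The collection `𝓘^a` of all intervals `[s,e] ⊆ [1,T]`. -/
def allIntervals (T : ℕ) : Set (ℕ × ℕ) :=
  {q | 1 ≤ q.1 ∧ q.1 ≤ q.2 ∧ q.2 ≤ T}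

/-- The collection `𝓘^d` of all intervals `[s,e] ⊆ [1,T]` of dyadic lengths
`e - s = 2^j - 1`, `j = 0, …, ⌊log₂ T⌋`. -/
def dyadicIntervals (T : ℕ) : Set (ℕ × ℕ) :=
  {q | 1 ≤ q.1 ∧ q.1 ≤ q.2 ∧ q.2 ≤ T ∧
    ∃ j : ℕ, j ≤ Nat.log 2 T ∧ q.2 - q.1 = 2 ^ j - 1}

/-- Restriction `𝓘_{[s,e]}` of a collection of intervals to those contained in `[s,e]`. -/
def restrictTo (I : Set (ℕ × ℕ)) (s e : ℕ) : Set (ℕ × ℕ) :=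
  {q ∈ I | s ≤ q.1 ∧ q.2 ≤ e}

/-- `D_{[s,e]} = inf_β ‖Y_{s:e} − X_{s:e,·}β‖_{𝓘^d_{[s,e]}}`. -/
noncomputable def Ddev {p : ℕ} (T : ℕ) (X : ℕ → Fin p → ℝ) (Y : ℕ → ℝ) (s e : ℕ) : ℝ :=
  sInf (Set.range fun β : Fin p → ℝ =>
    mrNorm (fun t => Y t - ∑ i, X t i * β i) (restrictTo (dyadicIntervals T) s e))

theorem mrNorm_nonneg (y : ℕ → ℝ) (I : Set (ℕ × ℕ)) : 0 ≤ mrNorm y I := by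
  apply Real.sSup_nonneg
  rintro _ ⟨q, -, rfl⟩
  exact abs_nonneg _

theorem allIntervals_finite (T : ℕ) : (allIntervals T).Finite := by
  refine ((Set.finite_Iic T).prod (Set.finite_Iic T)).subset ?_
  rintro ⟨a, b⟩ ⟨-, hab, hb⟩
  exact ⟨hab.trans hb, hb⟩

theorem abs_scaledPartialSum_le_mrNorm {y : ℕ → ℝ} {I : Set (ℕ × ℕ)} (hI : I.Finite)
    {q : ℕ × ℕ} (hq : q ∈ I) : |scaledPartialSum y q.1 q.2| ≤ mrNorm y I :=
  le_csSup (hI.image _).bddAbove (Set.mem_image_of_mem _ hq)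

theorem scaledPartialSum_congr {y z : ℕ → ℝ} {s e : ℕ} (h : ∀ u ∈ Finset.Icc s e, y u = z u) :
    scaledPartialSum y s e = scaledPartialSum z s e := by
  rw [scaledPartialSum, scaledPartialSum, Finset.sum_congr rfl h]

theorem mrNorm_restrictTo_dyadicIntervals_le {y z : ℕ → ℝ} {T s e : ℕ}
    (h : ∀ u ∈ Finset.Icc s e, y u = z u) :
    mrNorm y (restrictTo (dyadicIntervals T) s e) ≤ mrNorm z (allIntervals T) := by
  refine Real.sSup_le ?_ (mrNorm_nonneg _ _)
  rintro _ ⟨q, ⟨⟨h1, h2, h3, -⟩, hsq, hqe⟩, rfl⟩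
  have hq : q ∈ allIntervals T := ⟨h1, h2, h3⟩
  dsimp only
  rw [scaledPartialSum_congr fun u hu => h u (Finset.Icc_subset_Icc hsq hqe hu)]
  exact abs_scaledPartialSum_le_mrNorm (allIntervals_finite T) hq

theorem Ddev_le {p : ℕ} (T : ℕ) (X : ℕ → Fin p → ℝ) (Y : ℕ → ℝ) (s e : ℕ) (b : Fin p → ℝ) :
    Ddev T X Y s e ≤
      mrNorm (fun t => Y t - ∑ i, X t i * b i) (restrictTo (dyadicIntervals T) s e) := by
  refine csInf_le ⟨0, ?_⟩ ⟨b, rfl⟩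
  rintro _ ⟨c, rfl⟩
  exact mrNorm_nonneg _ _

/-- An interval without change-points lies in a single segment. -/
theorem exists_segment_of_no_changepoint {T N s e : ℕ} {η : ℕ → ℕ}
    (hη0 : η 0 = 0) (hηlast : η (N + 1) = T) (hs : 1 ≤ s) (hse : s ≤ e) (heT : e ≤ T)
    (hnocp : ∀ j, 1 ≤ j → j ≤ N → ¬ (s ≤ η j ∧ η j + 1 ≤ e)) :
    ∃ j ≤ N, η j < s ∧ e ≤ η (j + 1) := by
  classical
  have hex : ∃ k, s ≤ η k := ⟨N + 1, by omega⟩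
  have hle : Nat.find hex ≤ N + 1 := Nat.find_min' hex (by omega)
  have hspec : s ≤ η (Nat.find hex) := Nat.find_spec hex
  have hne : Nat.find hex ≠ 0 := by
    intro h
    rw [h] at hspec
    omega
  obtain ⟨j, hj⟩ := Nat.exists_eq_succ_of_ne_zero hne
  have hmin : ¬ s ≤ η j := Nat.find_min hex (by omega)
  rw [hj] at hspec hle
  refine ⟨j, by omega, by omega, ?_⟩
  rcases Nat.lt_or_ge j N with h | h
  · have := hnocp (j + 1) (by omega) (by omega)
    change s ≤ η (j + 1) at hspec
    omega
  · obtain rfl : j = N := by omega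
    omega

/-- if `[s,e] ⊆ [1,T]` contains no change-point, then for
every `t ≥ 0`, `P(D_{[s,e]} > t) ≤ P(‖Z‖_{𝓘^a} > t)`. -/
theorem stmt_14 {Ω : Type*} [MeasurableSpace Ω] (P : MeasureTheory.Measure Ω)
    [MeasureTheory.IsProbabilityMeasure P]
    (T p N : ℕ) (X : ℕ → Fin p → ℝ) (Z : Ω → ℕ → ℝ) (Y : Ω → ℕ → ℝ)
    (η : ℕ → ℕ) (β : ℕ → Fin p → ℝ)
    (hη0 : η 0 = 0) (hηlast : η (N + 1) = T)
    (hmono : ∀ j ≤ N, η j < η (j + 1))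
    (hmodel : ∀ ω, ∀ j ≤ N, ∀ u, η j < u → u ≤ η (j + 1) →
      Y ω u = (∑ i, X u i * β j i) + Z ω u)
    (s e : ℕ) (hs : 1 ≤ s) (hse : s ≤ e) (heT : e ≤ T)
    (hnocp : ∀ j, 1 ≤ j → j ≤ N → ¬ (s ≤ η j ∧ η j + 1 ≤ e)) :
    ∀ t : ℝ, 0 ≤ t →
      P {ω | Ddev T X (Y ω) s e > t} ≤ P {ω | mrNorm (Z ω) (allIntervals T) > t} := by
  obtain ⟨j, hjN, hjs, hej⟩ := exists_segment_of_no_changepoint hη0 hηlast hs hse heT hnocp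
  intro t _
  refine measure_mono fun ω (hω : t < Ddev T X (Y ω) s e) => ?_
  refine hω.trans_le ((Ddev_le T X (Y ω) s e (β j)).trans
    (mrNorm_restrictTo_dyadicIntervals_le fun u hu => ?_))
  obtain ⟨hsu, hue⟩ := Finset.mem_Icc.1 hu
  rw [hmodel ω j hjN u (hjs.trans_le hsu) (hue.trans hej), add_sub_cancel_left]
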